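/- For all integers k ≥ 3 and n ≥ 2k, ar*(n, K_{2k}) ≥ t_{k-1}(n) + n + ⌈n/(k-1)⌉ - k - 1, where t_{k-1}(n) denotes the number of edges of the Turán graph T_{k-1}(n) (the complete (k-1)-partite graph on n vertices with parts of sizes as equal as possible). -/

import Mathlib

open SimpleGraph

/-- An edge-colouring of the complete graph on `α` (only values on
non-diagonal pairs are relevant). -/
abbrev EdgeColouring (α : Type*) := Sym2 α → ℕ

/-- A star-colouring: every colour class is a star, i.e. any two edges of the
same colour share a vertex, and no colour class contains a triangle. -/
def IsStarColouring {α : Type*} (c : EdgeColouring α) : Prop :=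
  (∀ a b x y : α, a ≠ b → x ≠ y → c s(a, b) = c s(x, y) →
      a = x ∨ a = y ∨ b = x ∨ b = y) ∧
  ∀ a b d : α, a ≠ b → b ≠ d → a ≠ d →
      ¬(c s(a, b) = c s(b, d) ∧ c s(b, d) = c s(a, d))

/-- The number of colours used on the edges of the complete graph on `α`. -/
noncomputable def colourCount {α : Type*} (c : EdgeColouring α) : ℕ :=
  (c '' {e : Sym2 α | ¬ e.IsDiag}).ncard

/-- The colouring `c` of the complete graph on `α` contains a rainbow copy of
the graph `H`: there is an injection of `V(H)` such that distinct edges of `H`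
receive distinct colours. -/
def HasRainbowCopy {α β : Type*} (c : EdgeColouring α) (H : SimpleGraph β) : Prop :=
  ∃ f : β ↪ α, ∀ u v x y : β, H.Adj u v → H.Adj x y → s(u, v) ≠ s(x, y) →
    c s(f u, f v) ≠ c s(f x, f y)

/-- The star-anti-Ramsey number `ar*(n, H)`: the maximum number of colours in a
star-colouring of `K_n` with no rainbow copy of `H`. -/
noncomputable def starAntiRamsey (n : ℕ) {β : Type*} (H : SimpleGraph β) : ℕ :=
  sSup {s | ∃ c : EdgeColouring (Fin n), IsStarColouring c ∧ colourCount c = s ∧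
    ¬ HasRainbowCopy c H}

/-- The lexical colouring of `K_n`: the edge `{i, j}` with `i < j` gets colour `i`. -/
def lexColouring (n : ℕ) : EdgeColouring (Fin n) :=
  Sym2.lift ⟨fun i j => min i.1 j.1, fun i j => by simp [min_comm]⟩

/-- `c` is a lexical colouring with respect to some ordering of the vertices. -/
def IsLexical {n : ℕ} (c : EdgeColouring (Fin n)) : Prop :=
  ∃ v : Fin n ≃ Fin n, ∀ i j i' j' : Fin n, i < j → i' < j' →
    (c s(v i, v j) = c s(v i', v j') ↔ i = i')

/-- `v` is a centre of the colour class of colour `m`: the class is nonempty and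
every edge of colour `m` is incident to `v` (for star-colourings this is exactly
a vertex of maximum degree in the class). -/
def IsCentre {α : Type*} (c : EdgeColouring α) (v : α) (m : ℕ) : Prop :=
  (∃ e : Sym2 α, ¬ e.IsDiag ∧ c e = m ∧ v ∈ e) ∧
  ∀ e : Sym2 α, ¬ e.IsDiag → c e = m → v ∈ e

/-- `G` contains a copy of `F` as a subgraph. -/
def ContainsCopy {α β : Type*} (F : SimpleGraph α) (G : SimpleGraph β) : Prop :=
  ∃ f : α ↪ β, ∀ u v, F.Adj u v → G.Adj (f u) (f v)

/-- The extremal (Turán) number `ex(n, F)`. -/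
noncomputable def extremalNumber (n : ℕ) {α : Type*} (F : SimpleGraph α) : ℕ :=
  sSup {m | ∃ G : SimpleGraph (Fin n), ¬ ContainsCopy F G ∧ G.edgeSet.ncard = m}

/-- The join of two graphs: vertex-disjoint copies of `G` and `H` together with
all edges between them. -/
def graphJoin {α β : Type*} (G : SimpleGraph α) (H : SimpleGraph β) :
    SimpleGraph (α ⊕ β) :=
  SimpleGraph.fromRel (fun x y => match x, y with
    | Sum.inl a, Sum.inl b => G.Adj a b
    | Sum.inr a, Sum.inr b => H.Adj a b
    | Sum.inl _, Sum.inr _ => True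
    | Sum.inr _, Sum.inl _ => False)

/-- The complete bipartite graph `K_{s,t}` minus one edge. -/
def Kstminus (s t : ℕ) (hs : 0 < s) (ht : 0 < t) : SimpleGraph (Fin s ⊕ Fin t) :=
  (completeBipartiteGraph (Fin s) (Fin t)).deleteEdges
    {s(Sum.inl ⟨0, hs⟩, Sum.inr ⟨0, ht⟩)}

/-- The representative of the colour of `{i, j}` (where `i < j`) among the edges at `i`. Edges
between different residue classes modulo `r` represent themselves; inside a nonzero class all edges
from `i` upwards are identified; inside the zero class the edge from `i` to its successor `i + r` is
kept apart from the other edges from `i` upwards. -/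
def upperEndRep (r i j : ℕ) : ℕ :=
  if i % r ≠ j % r then j else if i % r ≠ 0 ∨ j = i + r then i + r else i + 2 * r

/-- The colouring of `K_n` that is rainbow between residue classes modulo `r`, lexical on every
nonzero class, and lexical with two colours per vertex on the zero class. -/
def residueColouring (r n : ℕ) : EdgeColouring (Fin n) :=
  Sym2.lift ⟨fun i j => Nat.pair (min i.1 j.1) (upperEndRep r (min i.1 j.1) (max i.1 j.1)),
    fun i j => by simp [min_comm, max_comm]⟩

lemma residueColouring_mk (r n : ℕ) (i j : Fin n) :
    residueColouring r n s(i, j) =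
      Nat.pair (min i.1 j.1) (upperEndRep r (min i.1 j.1) (max i.1 j.1)) := rfl

lemma residueColouring_of_lt {r n : ℕ} {i j : Fin n} (h : i < j) :
    residueColouring r n s(i, j) = Nat.pair i (upperEndRep r i j) := by
  have h' : i.1 ≤ j.1 := h.le
  rw [residueColouring_mk, min_eq_left h', max_eq_right h']

lemma isStarColouring_residueColouring (r n : ℕ) : IsStarColouring (residueColouring r n) := by
  constructor
  · intro a b x y _ _ h
    have : min a.1 b.1 = min x.1 y.1 := (Nat.pair_eq_pair.mp h).1
    simp only [Fin.ext_iff]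
    omega
  · rintro a b d hab hbd had ⟨h₁, h₂⟩
    have h₁ : min a.1 b.1 = min b.1 d.1 := (Nat.pair_eq_pair.mp h₁).1
    have h₂ : min b.1 d.1 = min a.1 d.1 := (Nat.pair_eq_pair.mp h₂).1
    simp only [ne_eq, Fin.ext_iff] at hab hbd had
    omega

lemma colourCount_le_card {α : Type*} [Fintype α] [DecidableEq α] (c : EdgeColouring α) :
    colourCount c ≤ Fintype.card (Sym2 α) :=
  (Set.ncard_image_le (Set.toFinite _)).trans <| by
    simpa [Nat.card_eq_fintype_card] using Set.ncard_le_card {e : Sym2 α | ¬ e.IsDiag}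

lemma colourCount_le_starAntiRamsey {n : ℕ} {β : Type*} {H : SimpleGraph β}
    {c : EdgeColouring (Fin n)} (hc : IsStarColouring c) (hH : ¬ HasRainbowCopy c H) :
    colourCount c ≤ starAntiRamsey n H := by
  refine le_csSup ⟨Fintype.card (Sym2 (Fin n)), ?_⟩ ⟨c, hc, rfl, hH⟩
  rintro _ ⟨d, -, rfl, -⟩
  exact colourCount_le_card d

/-- The pairs `i < j` that represent a colour of `residueColouring r n`. -/
def colourPairs (r n m : ℕ) : Finset (ℕ × ℕ) :=
  ((Finset.range n ×ˢ Finset.range n).filter fun p => p.1 < p.2 ∧ p.1 % r ≠ p.2 % r) ∪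
    ((Finset.range (n - r)).image (fun i => (i, i + r)) ∪
      (Finset.range m).image (fun q => (r * q, r * q + 2 * r)))

lemma ncard_edgeSet_turanGraph_le (n r : ℕ) :
    (turanGraph n r).edgeSet.ncard ≤
      ((Finset.range n ×ˢ Finset.range n).filter fun p => p.1 < p.2 ∧ p.1 % r ≠ p.2 % r).card := by
  rw [← Set.ncard_coe_finset]
  refine Set.ncard_le_ncard_of_injOn
    (fun e => Sym2.lift ⟨fun i j : Fin n => (min i.1 j.1, max i.1 j.1),
      fun i j => by simp [min_comm, max_comm]⟩ e) ?_ ?_ (Finset.finite_toSet _)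
  · intro e
    induction e with
    | _ i j =>
      intro h
      have h : i.1 % r ≠ j.1 % r := h
      rcases lt_trichotomy i.1 j.1 with hij | hij | hij
      · simp [hij.le, hij, h]
      · simp [hij] at h
      · simp [hij.le, hij, h.symm]
  · intro e _ e' _ h
    induction e with
    | _ i j =>
      induction e' with
      | _ x y =>
        simp only [Sym2.lift_mk, Prod.mk.injEq] at h
        simp only [Sym2.eq_iff, Fin.ext_iff]
        omega

lemma le_card_colourPairs {r : ℕ} (hr : 0 < r) (n m : ℕ) :
    (turanGraph n r).edgeSet.ncard + ((n - r) + m) ≤ (colourPairs r n m).card := by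
  rw [colourPairs, Finset.card_union_of_disjoint, Finset.card_union_of_disjoint,
    Finset.card_image_of_injective, Finset.card_image_of_injective, Finset.card_range,
    Finset.card_range]
  · exact Nat.add_le_add_right (ncard_edgeSet_turanGraph_le n r) _
  · intro a b h
    exact Nat.eq_of_mul_eq_mul_left hr (Prod.mk.inj h).1
  · intro a b h
    exact (Prod.mk.inj h).1
  · rw [Finset.disjoint_left]
    simp only [Finset.mem_image, not_exists, not_and]
    rintro _ ⟨i, -, rfl⟩ q - h
    obtain ⟨h₁, h₂⟩ := Prod.mk.inj h
    omega
  · rw [Finset.disjoint_left]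
    simp only [Finset.mem_filter, Finset.mem_union, Finset.mem_image]
    rintro p ⟨-, -, hp⟩ (⟨i, -, rfl⟩ | ⟨q, -, rfl⟩) <;> simp at hp

lemma card_colourPairs_le_colourCount {r n m : ℕ} (hr : 0 < r)
    (hm : ∀ q < m, r * q + 2 * r < n) :
    (colourPairs r n m).card ≤ colourCount (residueColouring r n) := by
  have hrep : ∀ p ∈ colourPairs r n m, p.1 < p.2 ∧ p.2 < n ∧ upperEndRep r p.1 p.2 = p.2 := by
    intro p hp
    simp only [colourPairs, Finset.mem_union, Finset.mem_filter, Finset.mem_image,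
      Finset.mem_product, Finset.mem_range] at hp
    rcases hp with ⟨⟨-, h₂⟩, h₃, h₄⟩ | ⟨i, hi, rfl⟩ | ⟨q, hq, rfl⟩
    · exact ⟨h₃, h₂, by simp [upperEndRep, h₄]⟩
    · exact ⟨by simp; omega, by simp; omega, by simp [upperEndRep]⟩
    · exact ⟨by simp; omega, hm q hq, by simp [upperEndRep]; omega⟩
  rw [← Set.ncard_coe_finset, colourCount]
  refine Set.ncard_le_ncard_of_injOn (fun p => Nat.pair p.1 p.2) ?_ ?_
    ((Set.toFinite _).image _)
  · intro p hp
    obtain ⟨h₁, h₂, h₃⟩ := hrep p hp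
    refine ⟨s(⟨p.1, h₁.trans h₂⟩, ⟨p.2, h₂⟩), ?_, ?_⟩
    · simpa [Fin.ext_iff] using h₁.ne
    · rw [residueColouring_of_lt (by simpa using h₁)]
      simp [h₃]
  · intro p _ p' _ h
    exact Prod.ext_iff.mpr (Nat.pair_eq_pair.mp h)

/-- Inside one residue class, a set in which edges sharing their lower end get distinct colours has
at most three vertices, and at most two if the class is nonzero. -/
lemma card_le_of_rainbow_residue {r n : ℕ} (F : Finset (Fin n)) (t : ℕ)
    (hF : ∀ v ∈ F, v.1 % r = t)
    (hrb : ∀ a ∈ F, ∀ b ∈ F, ∀ d ∈ F, a < b → a < d → b ≠ d →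
      residueColouring r n s(a, b) ≠ residueColouring r n s(a, d)) :
    F.card ≤ if t = 0 then 3 else 2 := by
  by_contra! hcard
  have hne : F.Nonempty := Finset.card_pos.mp (by omega)
  set a := F.min' hne
  have ha : a ∈ F := F.min'_mem hne
  have hlt : ∀ b ∈ F.erase a, a < b ∧ b ∈ F := fun b hb =>
    ⟨F.min'_lt_of_mem_erase_min' hne hb, Finset.mem_of_mem_erase hb⟩
  have hea : (F.erase a).card = F.card - 1 := Finset.card_erase_of_mem ha
  have hdiff : ∀ b ∈ F.erase a, ∀ d ∈ F.erase a, b ≠ d →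
      upperEndRep r a b ≠ upperEndRep r a d := by
    intro b hb d hd hbd h
    obtain ⟨hab, hb⟩ := hlt b hb
    obtain ⟨had, hd⟩ := hlt d hd
    refine hrb a ha b hb d hd hab had hbd ?_
    rw [residueColouring_of_lt hab, residueColouring_of_lt had, h]
  have hval : ∀ b ∈ F.erase a, upperEndRep r a b =
      if t ≠ 0 ∨ b.1 = a.1 + r then a.1 + r else a.1 + 2 * r := by
    intro b hb
    simp [upperEndRep, hF a ha, hF b (hlt b hb).2]
  split_ifs at hcard with ht
  · obtain ⟨b, hb, d, hd, e, he, hbd, hbe, hde⟩ :=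
      Finset.two_lt_card.mp (show 2 < (F.erase a).card by omega)
    have h₁ := hdiff b hb d hd hbd
    have h₂ := hdiff b hb e he hbe
    have h₃ := hdiff d hd e he hde
    rw [hval b hb, hval d hd] at h₁
    rw [hval b hb, hval e he] at h₂
    rw [hval d hd, hval e he] at h₃
    split_ifs at h₁ h₂ h₃ <;> omega
  · obtain ⟨b, hb, d, hd, hbd⟩ := Finset.one_lt_card.mp (show 1 < (F.erase a).card by omega)
    apply hdiff b hb d hd hbd
    rw [hval b hb, hval d hd]
    simp [ht]

lemma not_hasRainbowCopy_residueColouring {r : ℕ} (hr : 0 < r) (n N : ℕ) (hN : 2 * r + 1 < N) :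
    ¬ HasRainbowCopy (residueColouring r n) (⊤ : SimpleGraph (Fin N)) := by
  rintro ⟨f, hf⟩
  have hrb : ∀ a ∈ Finset.univ.map f, ∀ b ∈ Finset.univ.map f, ∀ d ∈ Finset.univ.map f,
      a < b → a < d → b ≠ d →
        residueColouring r n s(a, b) ≠ residueColouring r n s(a, d) := by
    simp only [Finset.mem_map, Finset.mem_univ, true_and]
    rintro _ ⟨a, rfl⟩ _ ⟨b, rfl⟩ _ ⟨d, rfl⟩ hab had hbd
    have hab' : a ≠ b := fun h => hab.ne (congrArg f h)
    have had' : a ≠ d := fun h => had.ne (congrArg f h)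
    have hbd' : b ≠ d := fun h => hbd (congrArg f h)
    refine hf a b a d hab' had' ?_
    simp only [ne_eq, Sym2.eq_iff]
    tauto
  have hcard := Finset.card_eq_sum_card_fiberwise (s := Finset.univ.map f)
    (t := Finset.range r) (f := fun v : Fin n => v.1 % r)
    (fun v _ => by simpa using Nat.mod_lt _ hr)
  have hle : ∑ t ∈ Finset.range r, ((Finset.univ.map f).filter fun v => v.1 % r = t).card ≤
      ∑ t ∈ Finset.range r, (2 + if t = 0 then 1 else 0) := by
    refine Finset.sum_le_sum fun t _ => ?_
    refine (card_le_of_rainbow_residue (r := r) _ t (by simp) fun a ha b hb d hd => ?_).trans ?_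
    · exact hrb a (Finset.mem_filter.mp ha).1 b (Finset.mem_filter.mp hb).1 d
        (Finset.mem_filter.mp hd).1
    · split_ifs <;> simp
  rw [Finset.card_map, Finset.card_univ, Fintype.card_fin] at hcard
  rw [← hcard, Finset.sum_add_distrib, Finset.sum_ite_eq'] at hle
  simp [hr] at hle
  omega

/-- For all integers `k ≥ 3` and `n ≥ 2k`,
`ar*(n, K_{2k}) ≥ t_{k-1}(n) + n + ⌈n/(k-1)⌉ - k - 1`, where `t_{k-1}(n)` is the
number of edges of the Turán graph `T_{k-1}(n)`. -/
theorem starAntiRamsey_evenClique_lower (k n : ℕ) (hk : 3 ≤ k) (hn : 2 * k ≤ n) :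
    (SimpleGraph.turanGraph n (k - 1)).edgeSet.ncard + n + (n + k - 2) / (k - 1)
        - k - 1
      ≤ starAntiRamsey n (⊤ : SimpleGraph (Fin (2 * k))) := by
  have hr : 0 < k - 1 := by omega
  refine le_trans ?_ (colourCount_le_starAntiRamsey
    (isStarColouring_residueColouring (k - 1) n)
    (not_hasRainbowCopy_residueColouring hr n (2 * k) (by omega)))
  set m := (n + k - 2) / (k - 1)
  have hm_mul : (k - 1) * m ≤ n + k - 2 := Nat.mul_div_le _ _
  refine le_trans ?_ ((le_card_colourPairs hr n (m - 2)).trans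
    (card_colourPairs_le_colourCount hr fun q hq => ?_))
  · have : 2 ≤ m := (Nat.le_div_iff_mul_le hr).mpr (by omega)
    omega
  · have : (k - 1) * (q + 3) ≤ (k - 1) * m := Nat.mul_le_mul_left _ (by omega)
    rw [Nat.mul_add] at this
    omega
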